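/- Let β > 0 and γ > 0. Then for every t ≥ 0 the Mittag-Leffler function satisfies the Volterra integral identity E_β(γ t^β) = 1 + (γ / Γ(β)) ∫_0^t (t − τ)^{β−1} E_β(γ τ^β) dτ. -/

import Mathlib

/-- The Mittag-Leffler function `E_β(x) = ∑_{k=0}^∞ x^k / Γ(β k + 1)`. -/
noncomputable def mittagLeffler (β x : ℝ) : ℝ :=
  ∑' k : ℕ, x ^ k / Real.Gamma (β * k + 1)

open MeasureTheory Set

/-- The lower bound `R ^ s * e ^ (-R) ≤ Γ(s + 1)`, from the part of Euler's integral over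
`(R, ∞)`. -/
theorem rpow_mul_exp_neg_le_Gamma {s R : ℝ} (hs : 0 ≤ s) (hR : 0 ≤ R) :
    R ^ s * Real.exp (-R) ≤ Real.Gamma (s + 1) := by
  have hconv := Real.GammaIntegral_convergent (s := s + 1) (by linarith)
  have hsub : Ioi R ⊆ Ioi 0 := Ioi_subset_Ioi hR
  rw [Real.Gamma_eq_integral (by linarith), ← integral_exp_neg_Ioi, ← integral_const_mul]
  calc ∫ x in Ioi R, R ^ s * Real.exp (-x)
      ≤ ∫ x in Ioi R, Real.exp (-x) * x ^ (s + 1 - 1) := by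
        refine setIntegral_mono_on ((integrableOn_exp_neg_Ioi R).const_mul _)
          (hconv.mono_set hsub) measurableSet_Ioi fun x hx => ?_
        rw [add_sub_cancel_right, mul_comm]
        gcongr
        exact (mem_Ioi.1 hx).le
    _ ≤ ∫ x in Ioi 0, Real.exp (-x) * x ^ (s + 1 - 1) := by
        refine setIntegral_mono_set hconv ?_ hsub.eventuallyLE
        filter_upwards [ae_restrict_mem measurableSet_Ioi] with x hx
        exact mul_nonneg (Real.exp_pos _).le (Real.rpow_nonneg (mem_Ioi.1 hx).le _)

/-- The Mittag-Leffler series converges absolutely on the whole real line. -/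
theorem summable_pow_div_Gamma {β : ℝ} (hβ : 0 < β) (x : ℝ) :
    Summable fun k : ℕ => x ^ k / Real.Gamma (β * k + 1) := by
  set y : ℝ := |x| + 1 with hy
  have hy_pos : 0 < y := by positivity
  set R : ℝ := y ^ β⁻¹ with hR
  have hR_pos : 0 < R := by positivity
  have hRβ : R ^ β = y := Real.rpow_inv_rpow hy_pos.le hβ.ne'
  have hgeom : Summable fun k : ℕ => Real.exp R * (|x| / y) ^ k :=
    (summable_geometric_of_lt_one (by positivity)
      ((div_lt_one hy_pos).2 (by linarith))).mul_left _
  refine hgeom.of_norm_bounded fun k => ?_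
  have hΓ : 0 < Real.Gamma (β * k + 1) := Real.Gamma_pos_of_pos (by positivity)
  have hle : y ^ k * Real.exp (-R) ≤ Real.Gamma (β * k + 1) := by
    rw [← hRβ, ← Real.rpow_mul_natCast hR_pos.le]
    exact rpow_mul_exp_neg_le_Gamma (by positivity) hR_pos.le
  rw [norm_div, norm_pow, Real.norm_eq_abs, Real.norm_of_nonneg hΓ.le]
  calc |x| ^ k / Real.Gamma (β * k + 1) ≤ |x| ^ k / (y ^ k * Real.exp (-R)) := by gcongr
    _ = Real.exp R * (|x| / y) ^ k := by
      rw [Real.exp_neg, div_pow]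
      field_simp

/-- Euler's beta integral over `[0, t]`. -/
theorem integral_sub_rpow_mul_rpow {a b t : ℝ} (ha : 0 < a) (hb : 0 < b) (ht : 0 < t) :
    ∫ τ in (0 : ℝ)..t, (t - τ) ^ (a - 1) * τ ^ (b - 1) =
      t ^ (a + b - 1) * (Real.Gamma a * Real.Gamma b / Real.Gamma (a + b)) := by
  have h := Complex.betaIntegral_scaled b a ht
  rw [Complex.betaIntegral_eq_Gamma_mul_div _ _ (by simpa) (by simpa)] at h
  rw [← Complex.ofReal_inj, ← intervalIntegral.integral_ofReal]
  calc ∫ τ in (0 : ℝ)..t, (((t - τ) ^ (a - 1) * τ ^ (b - 1) : ℝ) : ℂ)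
      = ∫ τ in (0 : ℝ)..t, (τ : ℂ) ^ ((b : ℂ) - 1) * ((t : ℂ) - τ) ^ ((a : ℂ) - 1) := by
        refine intervalIntegral.integral_congr fun τ hτ => ?_
        rw [uIcc_of_le ht.le] at hτ
        rw [Complex.ofReal_mul, Complex.ofReal_cpow (sub_nonneg.2 hτ.2),
          Complex.ofReal_cpow hτ.1, mul_comm]
        push_cast
        rfl
    _ = _ := by
        rw [h]
        push_cast [Complex.ofReal_cpow ht.le, ← Complex.Gamma_ofReal]
        rw [add_comm (b : ℂ), mul_comm (Complex.Gamma b)]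

theorem intervalIntegrable_sub_rpow_mul_rpow {a b t : ℝ} (ha : 0 < a) (hb : 0 < b)
    (ht : 0 < t) :
    IntervalIntegrable (fun τ => (t - τ) ^ (a - 1) * τ ^ (b - 1)) volume 0 t := by
  refine intervalIntegral.intervalIntegrable_of_integral_ne_zero ?_
  rw [integral_sub_rpow_mul_rpow ha hb ht]
  have := Real.Gamma_pos_of_pos ha
  have := Real.Gamma_pos_of_pos hb
  have := Real.Gamma_pos_of_pos (add_pos ha hb)
  positivity

/-- For `β > 0`, `γ > 0` and `t ≥ 0`, the Mittag-Leffler function satisfies the Volterra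
integral identity `E_β(γ t^β) = 1 + (γ / Γ(β)) ∫_0^t (t − τ)^(β−1) E_β(γ τ^β) dτ`. -/
theorem mittagLeffler_volterra (β γ : ℝ) (hβ : 0 < β) (hγ : 0 < γ) (t : ℝ) (ht : 0 ≤ t) :
    mittagLeffler β (γ * t ^ β) =
      1 + (γ / Real.Gamma β) *
        ∫ τ in (0:ℝ)..t, (t - τ) ^ (β - 1) * mittagLeffler β (γ * τ ^ β) := by
  rcases ht.eq_or_lt with rfl | ht
  · rw [Real.zero_rpow hβ.ne', mul_zero, mittagLeffler,
      tsum_eq_single 0 fun k hk => by simp [hk]]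
    simp
  have hΓ (k : ℕ) : 0 < Real.Gamma (β * k + 1) := Real.Gamma_pos_of_pos (by positivity)
  have hΓβ := Real.Gamma_pos_of_pos hβ
  set c : ℕ → ℝ := fun k => γ ^ k / Real.Gamma (β * k + 1) with hc
  have hc_nonneg (k : ℕ) : 0 ≤ c k := div_nonneg (by positivity) (hΓ k).le
  set F : ℕ → ℝ → ℝ := fun k τ => c k * ((t - τ) ^ (β - 1) * τ ^ ((β * k + 1) - 1)) with hF
  have hsum := summable_pow_div_Gamma hβ (γ * t ^ β)
  have hF_integral (k : ℕ) : ∫ τ in (0 : ℝ)..t, F k τ =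
      Real.Gamma β / γ * ((γ * t ^ β) ^ (k + 1) / Real.Gamma (β * (k + 1 : ℕ) + 1)) := by
    rw [intervalIntegral.integral_const_mul,
      integral_sub_rpow_mul_rpow hβ (by positivity) ht, mul_pow, ← Real.rpow_mul_natCast ht.le]
    have h₁ : β + (β * k + 1) - 1 = β * (k + 1 : ℕ) := by push_cast; ring
    have h₂ : β + (β * k + 1) = β * (k + 1 : ℕ) + 1 := by push_cast; ring
    rw [h₁, h₂, hc]
    have := hΓ k
    have := hΓ (k + 1)
    field_simp
    ring
  have hF_integrable (k : ℕ) : IntegrableOn (F k) (Ioc 0 t) :=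
    ((intervalIntegrable_sub_rpow_mul_rpow hβ (by positivity) ht).const_mul (c k)).1
  have hF_norm (k : ℕ) : ∫ τ in Ioc 0 t, ‖F k τ‖ = ∫ τ in (0 : ℝ)..t, F k τ := by
    rw [intervalIntegral.integral_of_le ht.le]
    refine setIntegral_congr_fun measurableSet_Ioc fun τ hτ => Real.norm_of_nonneg ?_
    exact mul_nonneg (hc_nonneg k) (mul_nonneg (Real.rpow_nonneg (sub_nonneg.2 hτ.2) _)
      (Real.rpow_nonneg hτ.1.le _))
  have hsum' := (summable_nat_add_iff 1).2 hsum
  have hsummable : Summable fun k => ∫ τ in Ioc 0 t, ‖F k τ‖ := by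
    simp_rw [hF_norm, hF_integral]
    exact hsum'.mul_left _
  have htsum : ∫ τ in (0 : ℝ)..t, (t - τ) ^ (β - 1) * mittagLeffler β (γ * τ ^ β) =
      ∑' k, ∫ τ in (0 : ℝ)..t, F k τ := by
    simp_rw [intervalIntegral.integral_of_le ht.le]
    rw [(hasSum_integral_of_summable_integral_norm hF_integrable hsummable).tsum_eq]
    refine setIntegral_congr_fun measurableSet_Ioc fun τ hτ => ?_
    simp only [mittagLeffler]
    rw [← tsum_mul_left]
    refine tsum_congr fun k => ?_
    simp only [hF, hc, add_sub_cancel_right]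
    rw [mul_pow, ← Real.rpow_mul_natCast hτ.1.le]
    ring
  rw [htsum]
  simp_rw [hF_integral]
  rw [tsum_mul_left, ← mul_assoc, div_mul_div_cancel₀ hΓβ.ne', div_self hγ.ne', one_mul,
    mittagLeffler, hsum.tsum_eq_zero_add]
  simp
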